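/- Kernel identity for the two resolvents: for every z ∈ ℂ with z ∉ σ(JQ) and z ∉ σ((J-R)Q), the kernels of the m-column matrices RQ·((J-R)Q - zI)⁻¹·B and RQ·(JQ - zI)⁻¹·B coincide: ker( RQ ((J-R)Q - zI)⁻¹ B ) = ker( RQ (JQ - zI)⁻¹ B ). -/

import Mathlib

open Matrix
open scoped ComplexOrder

/-- kernel of the linear map induced by a matrix -/
noncomputable def mker {a b : ℕ} (M : Matrix (Fin a) (Fin b) ℂ) : Submodule ℂ (Fin b → ℂ) :=
  LinearMap.ker M.mulVecLin

theorem mker_le_mker_mul_left {a b c : ℕ} (P : Matrix (Fin c) (Fin a) ℂ)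
    (M : Matrix (Fin a) (Fin b) ℂ) : mker M ≤ mker (P * M) := by
  intro v hv
  simp only [mker, LinearMap.mem_ker, mulVecLin_apply] at hv ⊢
  rw [← mulVec_mulVec, hv, mulVec_zero]

theorem isUnit_det_sub_smul_one {n : ℕ} {A : Matrix (Fin n) (Fin n) ℂ} {z : ℂ}
    (hz : z ∉ spectrum ℂ A) : IsUnit (A - z • 1).det := by
  rw [spectrum.notMem_iff, Algebra.algebraMap_eq_smul_one] at hz
  rw [← isUnit_iff_isUnit_det, ← neg_sub]
  exact hz.neg

/-- Perturbing an invertible `X` by a multiple of `C` can only enlarge `ker (C X⁻¹ B)`. -/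
theorem mker_mul_inv_le_of_sub_eq_smul {n m : ℕ} {X Y C : Matrix (Fin n) (Fin n) ℂ}
    (B : Matrix (Fin n) (Fin m) ℂ) (k : ℂ) (hX : IsUnit X.det) (hY : IsUnit Y.det)
    (h : X - Y = k • C) : mker (C * X⁻¹ * B) ≤ mker (C * Y⁻¹ * B) := by
  have key : Y⁻¹ = X⁻¹ + Y⁻¹ * (k • C) * X⁻¹ := by
    rw [← h, mul_sub, sub_mul, mul_assoc, mul_nonsing_inv X hX, nonsing_inv_mul Y hY]
    simp
  have factor : C * Y⁻¹ * B = (1 + k • (C * Y⁻¹)) * (C * X⁻¹ * B) := by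
    conv_lhs => rw [key]
    simp only [Matrix.mul_add, Matrix.add_mul, Matrix.one_mul, Matrix.mul_smul,
      Matrix.smul_mul, Matrix.mul_assoc]
  rw [factor]
  exact mker_le_mker_mul_left _ _

/-- Kernel identity for the two resolvents:
`ker(RQ ((J-R)Q - zI)⁻¹ B) = ker(RQ (JQ - zI)⁻¹ B)`
for `z` outside the spectra of `JQ` and `(J-R)Q`. -/
theorem kernel_resolvent_identity {n m : ℕ}
    (J R Q : Matrix (Fin n) (Fin n) ℂ) (B : Matrix (Fin n) (Fin m) ℂ)
    (hJ : Jᴴ = -J) (hR : R.PosSemidef) (hQ : Q.PosSemidef) :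
    ∀ z : ℂ, z ∉ spectrum ℂ (J * Q) → z ∉ spectrum ℂ ((J - R) * Q) →
      mker (R * Q * ((J - R) * Q - z • 1)⁻¹ * B)
        = mker (R * Q * (J * Q - z • 1)⁻¹ * B) := by
  intro z hz hz'
  have h := isUnit_det_sub_smul_one hz
  have h' := isUnit_det_sub_smul_one hz'
  apply le_antisymm
  · exact mker_mul_inv_le_of_sub_eq_smul B (-1) h' h (by rw [sub_mul, neg_one_smul]; abel)
  · exact mker_mul_inv_le_of_sub_eq_smul B 1 h h' (by rw [sub_mul, one_smul]; abel)
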